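/- Let 𝔣 be continuous of bounded variation with ∫_𝕋 𝔣(x) dx = 0, let 𝔭(x) = e^{𝔣(x)}/(1+e^{𝔣(x)}), and let μ_* be the unique stationary measure of the kernel p(x,·) = 𝔭(x)δ_{x+α} + 𝔮(x)δ_{x−α}. Then μ_* is ergodic with respect to the two-step kernel: every Borel set A ⊆ 𝕋 such that p₂(x, A) = 1 for μ_*-almost every x ∈ A satisfies μ_*(A) = 0 or μ_*(A) = 1, where p₂(x,·) = 𝔭(x)² δ_{x+2α} + 2𝔭(x)𝔮(x) δ_x + 𝔮(x)² δ_{x−2α}. -/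

import Mathlib

open MeasureTheory Filter Finset

noncomputable section

attribute [local instance] Classical.propDecidable

/-- The point `x + j·α` on the circle `𝕋 = ℝ/ℤ`. -/
def pt (α : ℝ) (x : UnitAddCircle) (j : ℤ) : UnitAddCircle :=
  x + (((j : ℝ) * α : ℝ) : UnitAddCircle)

/-- `𝔣` is continuous, of bounded variation, with `∫_𝕋 𝔣(z) dz = 0`. -/
def ZeroMeanBV (𝔣 : UnitAddCircle → ℝ) : Prop :=
  Continuous 𝔣 ∧ BoundedVariationOn (fun t : ℝ => 𝔣 (t : UnitAddCircle)) (Set.Icc 0 1) ∧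
    ∫ z : UnitAddCircle, 𝔣 z = 0

/-- The function `𝔭 = e^𝔣/(1+e^𝔣)` associated to `𝔣`. -/
def pOf (𝔣 : UnitAddCircle → ℝ) : UnitAddCircle → ℝ :=
  fun z => Real.exp (𝔣 z) / (1 + Real.exp (𝔣 z))

/-- `q` is a close return time of `α`: `q` is the denominator of a rational
approximation with `|α - p/q| < 1/q²`. -/
def CloseReturnTime (α : ℝ) (q : ℕ) : Prop :=
  0 < q ∧ ∃ p : ℤ, |α - (p : ℝ) / (q : ℝ)| < 1 / (q : ℝ) ^ 2

/-- The Markov operator associated to the transition kernel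
`p(x,·) = 𝔭(x) δ_{x+α} + (1-𝔭(x)) δ_{x-α}`, acting on Borel measures on the circle:
`(Pν)(A) = ∫ p(x,A) ν(dx)`. -/
def Pop (𝔭 : UnitAddCircle → ℝ) (α : ℝ) (ν : Measure UnitAddCircle) :
    Measure UnitAddCircle :=
  (ν.withDensity fun z => ENNReal.ofReal (𝔭 z)).map
      (fun z => z + ((α : ℝ) : UnitAddCircle)) +
    (ν.withDensity fun z => ENNReal.ofReal (1 - 𝔭 z)).map
      (fun z => z - ((α : ℝ) : UnitAddCircle))

/-- `μ` is the unique stationary (invariant) probability measure of the kernel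
`p(x,·) = 𝔭(x) δ_{x+α} + (1-𝔭(x)) δ_{x-α}`. -/
def IsUniqueStationary (𝔭 : UnitAddCircle → ℝ) (α : ℝ) (μ : Measure UnitAddCircle) : Prop :=
  IsProbabilityMeasure μ ∧ Pop 𝔭 α μ = μ ∧
    ∀ ν : Measure UnitAddCircle, IsProbabilityMeasure ν → Pop 𝔭 α ν = ν → ν = μ

lemma aux_bezout (α : ℝ) (D : ℕ) (n : ℤ) (q : ℕ) (p s : ℤ) (hD : 0 < D) (hq : 0 < q) (hqD : q ≤ D)
    (hs : |s| = 1) (h : (q : ℤ) * n - p * D = s) (hα : |D * α - n| ≤ 1 / D) :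
    IsCoprime p q ∧ |q * α - p| ≤ 2 / q := by
  have hDr : (0 : ℝ) < D := by exact_mod_cast hD
  have hqr : (0 : ℝ) < q := by exact_mod_cast hq
  have hqDr : (q : ℝ) ≤ D := by exact_mod_cast hqD
  constructor
  · refine ⟨-D * s, n * s, ?_⟩
    have : s * s = 1 := by
      rw [← abs_mul_abs_self, hs]; norm_num
    linear_combination s * h + this
  · have h1 : (D : ℝ) * (q * α - p) = q * (D * α - n) + s := by
      have : ((q : ℝ)) * n - p * D = s := by exact_mod_cast h
      linear_combination this
    have hs' : |(s : ℝ)| = 1 := by exact_mod_cast hs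
    have h2 : (D : ℝ) * |q * α - p| ≤ 2 := by
      calc (D : ℝ) * |q * α - p| = |(D : ℝ) * (q * α - p)| := by rw [abs_mul, abs_of_pos hDr]
        _ = |q * (D * α - n) + s| := by rw [h1]
        _ ≤ |(q : ℝ) * (D * α - n)| + |(s : ℝ)| := abs_add_le _ _
        _ = q * |D * α - n| + 1 := by rw [abs_mul, abs_of_pos hqr, hs']
        _ ≤ D * (1 / D) + 1 := by gcongr
        _ = 2 := by field_simp; norm_num
    rw [le_div_iff₀ hqr]
    calc |q * α - p| * q ≤ |q * α - p| * D := by gcongr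
      _ ≤ 2 := by linarith

lemma odd_return (α : ℝ) (hα : Irrational α) (N : ℕ) :
    ∃ (q : ℕ) (p : ℤ), N < q ∧ Odd q ∧ IsCoprime p (q : ℤ) ∧ |q * α - p| ≤ 2 / q := by
  have h0 := hα.eventually_forall_le_dist_cast_rat_of_den_le (2 * N + 2)
  obtain ⟨ε, hε, hε0⟩ := ((h0.filter_mono nhdsWithin_le_nhds).and
    (self_mem_nhdsWithin : Set.Ioi (0 : ℝ) ∈ nhdsWithin 0 (Set.Ioi 0))).exists
  have hε0 : 0 < ε := hε0
  obtain ⟨n, hn⟩ := exists_nat_one_div_lt hε0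
  obtain ⟨r, hr, hrn⟩ := Real.exists_rat_abs_sub_le_and_den_le α (n := n + 1) (by omega)
  have hD : 0 < r.den := r.den_pos
  have hDr : (0 : ℝ) < r.den := by exact_mod_cast hD
  have hD1 : (1 : ℝ) ≤ r.den := by exact_mod_cast hD
  have hlarge : 2 * N + 2 < r.den := by
    by_contra hcon
    have h1 := hε r (by omega)
    rw [Real.dist_eq] at h1
    have : 1 / (((n + 1 : ℕ) : ℝ) + 1) / r.den ≤ 1 / ((n : ℝ) + 1) := by
      rw [div_div]
      apply one_div_le_one_div_of_le (by positivity)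
      push_cast
      nlinarith [(Nat.cast_nonneg n : (0 : ℝ) ≤ n)]
    rw [div_div] at this
    linarith
  have hrr : (r : ℝ) = r.num / r.den := by
    exact_mod_cast (Rat.num_div_den r).symm
  have happ : |r.den * α - r.num| ≤ 1 / (r.den : ℝ) := by
    have : (r.den : ℝ) * α - r.num = r.den * (α - r) := by rw [hrr]; field_simp
    rw [this, abs_mul, abs_of_pos hDr]
    calc (r.den : ℝ) * |α - r| ≤ r.den * (1 / ((((n + 1 : ℕ) : ℝ) + 1) * r.den)) := by gcongr
      _ = 1 / (((n + 1 : ℕ) : ℝ) + 1) := by field_simp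
      _ ≤ 1 / r.den := by
        apply one_div_le_one_div_of_le hDr
        have : (r.den : ℝ) ≤ (n + 1 : ℕ) := by exact_mod_cast hrn
        linarith
  have hcop : IsCoprime r.num (r.den : ℤ) := by
    rw [Int.isCoprime_iff_nat_coprime]; simpa using r.reduced
  rcases Nat.even_or_odd r.den with he | ho
  · obtain ⟨u, v, huv⟩ := hcop
    have hDz : (0 : ℤ) < r.den := by exact_mod_cast hD
    obtain ⟨u0, hu0⟩ : ∃ u0 : ℕ, (u0 : ℤ) = u % r.den :=
      ⟨(u % r.den).toNat, Int.toNat_of_nonneg (Int.emod_nonneg _ hDz.ne')⟩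
    have hlt : u0 < r.den := by
      have := Int.emod_lt_of_pos u hDz
      omega
    have hdm := Int.emod_add_mul_ediv u r.den
    rw [← hu0] at hdm
    obtain ⟨v', hv'⟩ : ∃ v', v' = v + (u / r.den) * r.num := ⟨_, rfl⟩
    have hb : (u0 : ℤ) * r.num + v' * r.den = 1 := by
      rw [hv']; linear_combination huv + r.num * hdm
    have hodd : Odd u0 := by
      have heZ : Even ((r.den : ℕ) : ℤ) := by exact_mod_cast he
      by_contra hcon
      rw [Nat.not_odd_iff_even] at hcon
      have hcZ : Even (u0 : ℤ) := by exact_mod_cast hcon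
      have : Even ((u0 : ℤ) * r.num + v' * r.den) := (hcZ.mul_right _).add (heZ.mul_left _)
      rw [hb] at this
      exact absurd this (by decide)
    by_cases hc : r.den ≤ 2 * u0
    · have hx := aux_bezout α r.den r.num u0 (-v') 1 hD hodd.pos hlt.le (by simp)
        (by linear_combination hb) happ
      exact ⟨u0, -v', by omega, hodd, hx⟩
    · have hx := aux_bezout α r.den r.num (r.den - u0) (r.num + v') (-1) hD (by omega) (by omega)
        (by simp) (by push_cast [hlt.le]; linear_combination -hb) happ
      exact ⟨r.den - u0, r.num + v', by omega, Nat.Even.sub_odd hlt.le he hodd, hx⟩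
  · refine ⟨r.den, r.num, by omega, ho, hcop, happ.trans ?_⟩
    gcongr; norm_num

lemma sum_range_zmod (q : ℕ) [NeZero q] (p : ℤ) (hp : IsCoprime p (q : ℤ)) (h : ZMod q → ℝ) :
    ∑ j ∈ range q, h ((j : ZMod q) * p) = ∑ k : ZMod q, h k := by
  have hu : IsUnit (p : ZMod q) := (ZMod.coe_int_isUnit_iff_isCoprime p q).mpr hp.symm
  obtain ⟨u, hu⟩ := hu
  rw [← hu, ← Equiv.sum_comp (Units.mulRight u) h]
  refine Finset.sum_nbij' (fun j => (j : ZMod q)) (fun k => k.val) ?_ ?_ ?_ ?_ ?_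
  · simp
  · intro k _; simpa using ZMod.val_lt k
  · intro j hj; simp at hj; simp [ZMod.val_natCast, Nat.mod_eq_of_lt hj]
  · intro k _; simp
  · intro j _; simp

lemma sum_range_val (q : ℕ) [NeZero q] (h : ℕ → ℝ) :
    ∑ k : ZMod q, h k.val = ∑ k ∈ range q, h k := by
  symm
  refine Finset.sum_nbij' (fun j => (j : ZMod q)) (fun k => k.val) ?_ ?_ ?_ ?_ ?_
  · simp
  · intro k _; simpa using ZMod.val_lt k
  · intro j hj; simp at hj; simp [ZMod.val_natCast, Nat.mod_eq_of_lt hj]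
  · intro k _; simp
  · intro j hj; simp at hj; simp [ZMod.val_natCast, Nat.mod_eq_of_lt hj]

lemma telesc (w : ℕ → ℝ) (q : ℕ) :
    ∑ k ∈ range q, (w (k + 4) - w k) = ∑ i ∈ range 4, (w (q + i) - w i) := by
  induction q with
  | zero => simp
  | succ q ih =>
    rw [Finset.sum_range_succ, ih]
    simp only [Finset.sum_range_succ, Finset.sum_range_zero]
    rw [show q + 1 + 0 = q + 1 by ring, show q + 1 + 1 = q + 2 by ring, show q + 1 + 2 = q + 3 by ring,
      show q + 1 + 3 = q + 4 by ring]
    ring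

set_option maxHeartbeats 1000000 in
lemma dk_core (f : UnitAddCircle → ℝ) (u v : ℝ → ℝ) (hu : MonotoneOn u (Set.Icc (-2) 3))
    (hv : MonotoneOn v (Set.Icc (-2) 3)) (huv : (fun t : ℝ => f (t : UnitAddCircle)) = u - v)
    (α : ℝ) (q : ℕ) [NeZero q] (p : ℤ) (hp : IsCoprime p (q : ℤ)) (hα : |q * α - p| ≤ 2 / q)
    (x t : ℝ) (hx0 : 0 ≤ x) (hx1 : x ≤ 1) (ht0 : 0 ≤ t) (ht1 : t ≤ 1 / q) :
    |∑ j ∈ range q, f ((x : UnitAddCircle) + j • (α : UnitAddCircle)) -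
      ∑ k : ZMod q, f (((x + t : ℝ) : UnitAddCircle) + ZMod.toAddCircle k)| ≤
      4 * ((u 3 + v 3) - (u (-2) + v (-2))) := by
  have hq : 0 < q := Nat.pos_of_ne_zero (NeZero.ne q)
  have hqr : (0 : ℝ) < q := by exact_mod_cast hq
  set w : ℕ → ℝ := fun k => u (x + ((k : ℝ) - 2) / q) + v (x + ((k : ℝ) - 2) / q) with hw
  have hmem : ∀ k : ℕ, k < q + 4 → x + ((k : ℝ) - 2) / q ∈ Set.Icc (-2 : ℝ) 3 := by
    intro k hk
    have hk' : (k : ℝ) ≤ q + 3 := by exact_mod_cast (by omega : k ≤ q + 3)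
    have hq1 : (1 : ℝ) ≤ q := by exact_mod_cast hq
    constructor
    · have : -2 ≤ ((k : ℝ) - 2) / q := by
        rw [le_div_iff₀ hqr]; nlinarith [(Nat.cast_nonneg k : (0 : ℝ) ≤ k)]
      linarith
    · have : ((k : ℝ) - 2) / q ≤ 2 := by
        rw [div_le_iff₀ hqr]; nlinarith
      linarith
  rw [← sum_range_zmod q p hp, ← Finset.sum_sub_distrib]
  calc _ ≤ ∑ j ∈ range q, |f ((x : UnitAddCircle) + j • (α : UnitAddCircle)) -
          f (((x + t : ℝ) : UnitAddCircle) + ZMod.toAddCircle ((j : ZMod q) * (p : ZMod q)))| :=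
        Finset.abs_sum_le_sum_abs _ _
    _ ≤ ∑ j ∈ range q, (fun k : ZMod q => w (k.val + 4) - w k.val) ((j : ZMod q) * (p : ZMod q)) := by
        apply Finset.sum_le_sum
        intro j hj
        simp only [Finset.mem_range] at hj
        set k : ℕ := ((j : ZMod q) * (p : ZMod q)).val with hk
        have hkq : k < q := ZMod.val_lt _
        obtain ⟨m, hm⟩ : ∃ m : ℤ, (j : ℤ) * p = k + q * m := by
          have : (((j : ℤ) * p : ℤ) : ZMod q) = ((k : ℤ) : ZMod q) := by
            rw [hk]; push_cast; simp
          rw [ZMod.intCast_eq_intCast_iff_dvd_sub] at this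
          obtain ⟨m, hm⟩ := this
          exact ⟨-m, by linear_combination -hm⟩
        have hmr : (j : ℝ) * p = k + q * m := by exact_mod_cast hm
        set d : ℝ := j * (q * α - p) / q with hd
        have hjq : (j : ℝ) ≤ q := by exact_mod_cast hj.le
        have hdle : |d| ≤ 2 / q := by
          rw [hd, abs_div, abs_mul, abs_of_pos hqr, Nat.abs_cast, div_le_iff₀ hqr]
          calc (j : ℝ) * |q * α - p| ≤ q * (2 / q) := by gcongr
            _ = _ := mul_comm _ _
        have e1 : (x : UnitAddCircle) + j • (α : UnitAddCircle) = ((x + k / q + d : ℝ) : UnitAddCircle) := by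
          have : x + j • α = x + k / q + d + m • (1 : ℝ) := by
            rw [hd]; simp only [nsmul_eq_mul, zsmul_eq_mul]; field_simp; linear_combination hmr
          rw [← AddCircle.coe_nsmul, ← AddCircle.coe_add, this, AddCircle.coe_add,
            AddCircle.coe_zsmul, AddCircle.coe_period]; simp
        have e2 : ((x + t : ℝ) : UnitAddCircle) + ZMod.toAddCircle ((j : ZMod q) * (p : ZMod q)) =
            ((x + k / q + t : ℝ) : UnitAddCircle) := by
          rw [ZMod.toAddCircle_apply, ← hk, ← AddCircle.coe_add]; congr 1; ring
        have hg : ∀ s : ℝ, f (s : UnitAddCircle) = u s - v s := fun s => congrFun huv s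
        rw [e1, e2, hg, hg]
        show _ ≤ w (k + 4) - w k
        have hma := hmem k (by omega)
        have hmb := hmem (k + 4) (by omega)
        simp only [hw]
        push_cast at hmb ⊢
        rw [abs_le] at hdle
        have ea : x + ((k : ℝ) - 2) / q = x + k / q - 2 / q := by ring
        have eb : x + ((k : ℝ) + 4 - 2) / q = x + k / q + 2 / q := by ring
        have h12 : (1 : ℝ) / q ≤ 2 / q := by gcongr; norm_num
        have hpos : (0 : ℝ) < 2 / q := by positivity
        rw [ea] at hma ⊢
        rw [eb] at hmb ⊢
        obtain ⟨ha1, ha2⟩ := hma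
        obtain ⟨hb1, hb2⟩ := hmb
        have hs1 : x + k / q + d ∈ Set.Icc (-2 : ℝ) 3 := ⟨by linarith, by linarith⟩
        have hs2 : x + k / q + t ∈ Set.Icc (-2 : ℝ) 3 := ⟨by linarith, by linarith⟩
        have u1 := hu ⟨ha1, ha2⟩ hs1 (by linarith)
        have u2 := hu ⟨ha1, ha2⟩ hs2 (by linarith)
        have u3 := hu hs1 ⟨hb1, hb2⟩ (by linarith)
        have u4 := hu hs2 ⟨hb1, hb2⟩ (by linarith)
        have v1 := hv ⟨ha1, ha2⟩ hs1 (by linarith)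
        have v2 := hv ⟨ha1, ha2⟩ hs2 (by linarith)
        have v3 := hv hs1 ⟨hb1, hb2⟩ (by linarith)
        have v4 := hv hs2 ⟨hb1, hb2⟩ (by linarith)
        rw [abs_le]
        constructor <;> linarith
    _ = ∑ k ∈ range q, (w (k + 4) - w k) := by
        rw [sum_range_zmod q p hp (fun k : ZMod q => w (k.val + 4) - w k.val),
          sum_range_val q (fun k => w (k + 4) - w k)]
    _ = ∑ i ∈ range 4, (w (q + i) - w i) := telesc w q
    _ ≤ ∑ i ∈ range 4, ((u 3 + v 3) - (u (-2) + v (-2))) := by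
        apply Finset.sum_le_sum
        intro i hi
        simp only [Finset.mem_range] at hi
        have m1 := hmem (q + i) (by omega)
        have m2 := hmem i (by omega)
        have l : (-2 : ℝ) ∈ Set.Icc (-2 : ℝ) 3 := by norm_num
        have r : (3 : ℝ) ∈ Set.Icc (-2 : ℝ) 3 := by norm_num
        have := hu m1 r m1.2
        have := hv m1 r m1.2
        have := hu l m2 m2.1
        have := hv l m2 m2.1
        simp only [hw]
        linarith
    _ = _ := by rw [Finset.sum_const, Finset.card_range, nsmul_eq_mul]; norm_num

lemma bv_ext (f : UnitAddCircle → ℝ)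
    (h : BoundedVariationOn (fun t : ℝ => f (t : UnitAddCircle)) (Set.Icc 0 1)) :
    BoundedVariationOn (fun t : ℝ => f (t : UnitAddCircle)) (Set.Icc (-2) 3) := by
  set g : ℝ → ℝ := fun t : ℝ => f (t : UnitAddCircle) with hg
  have hper : ∀ m : ℤ, g ∘ (fun t => t - m) = g := by
    intro m; ext t
    have : t - (m : ℝ) = t + (-m) • (1 : ℝ) := by simp; ring
    simp only [hg, Function.comp, this]
    rw [AddCircle.coe_add, AddCircle.coe_zsmul, AddCircle.coe_period]; simp
  have hm : ∀ m : ℤ, eVariationOn g (Set.Icc (m : ℝ) (m + 1)) ≠ ⊤ := by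
    intro m
    have := eVariationOn.comp_le_of_monotoneOn g (s := Set.Icc 0 1) (t := Set.Icc (m : ℝ) (m + 1))
      (fun t => t - m) (fun a _ b _ hab => by simpa using hab)
      (fun a ha => ⟨by simpa using ha.1, by have := ha.2; simp; linarith⟩)
    rw [hper] at this
    exact ne_top_of_le_ne_top h this
  have hn : ∀ n : ℕ, eVariationOn g (Set.Icc (-2 : ℝ) (-2 + n)) ≠ ⊤ := by
    intro n
    induction n with
    | zero => simp [eVariationOn.subsingleton]
    | succ n ih =>
      have := eVariationOn.Icc_add_Icc g (s := Set.univ) (a := -2) (b := -2 + n) (c := -2 + (n + 1 : ℕ))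
        (by simp) (by simp) (Set.mem_univ _)
      simp only [Set.univ_inter] at this
      rw [← this]
      have h2 := hm (-2 + n)
      push_cast at h2 ⊢
      rw [← add_assoc]
      exact ENNReal.add_ne_top.2 ⟨ih, h2⟩
  have := hn 5
  norm_num at this
  exact this

lemma dk_upper (f : UnitAddCircle → ℝ) (hf : Continuous f) (h0 : ∫ z : UnitAddCircle, f z = 0)
    (C : ℝ) (u v : ℝ → ℝ) (hu : MonotoneOn u (Set.Icc (-2) 3))
    (hv : MonotoneOn v (Set.Icc (-2) 3)) (huv : (fun t : ℝ => f (t : UnitAddCircle)) = u - v)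
    (hC : C = 4 * ((u 3 + v 3) - (u (-2) + v (-2))))
    (α : ℝ) (q : ℕ) [NeZero q] (p : ℤ) (hp : IsCoprime p (q : ℤ)) (hα : |q * α - p| ≤ 2 / q)
    (x : UnitAddCircle) : |∑ j ∈ range q, f (x + j • (α : UnitAddCircle))| ≤ C := by
  have hq : 0 < q := Nat.pos_of_ne_zero (NeZero.ne q)
  have hqr : (0 : ℝ) < q := by exact_mod_cast hq
  obtain ⟨x0, hx0, rfl⟩ : ∃ x0 : ℝ, x0 ∈ Set.Ico (0 : ℝ) 1 ∧ (x0 : UnitAddCircle) = x := by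
    have := AddCircle.coe_image_Ico_eq (1 : ℝ) 0
    have hx : x ∈ (QuotientAddGroup.mk '' Set.Ico (0 : ℝ) (0 + 1) : Set UnitAddCircle) := by
      rw [this]; trivial
    obtain ⟨x0, h, h'⟩ := hx
    exact ⟨x0, by simpa using h, h'⟩
  set S := ∑ j ∈ range q, f ((x0 : UnitAddCircle) + j • (α : UnitAddCircle)) with hS
  set F : UnitAddCircle → ℝ := fun y => ∑ k : ZMod q, f (y + ZMod.toAddCircle k) with hF
  have key : ∀ y, |S - F y| ≤ C := by
    intro y
    obtain ⟨y0, rfl⟩ := QuotientAddGroup.mk_surjective y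
    set m : ℤ := ⌊(y0 - x0) * q⌋ with hm
    set t : ℝ := (y0 - x0) - m / q with ht
    have h1 := Int.floor_le ((y0 - x0) * q)
    have h2 := Int.lt_floor_add_one ((y0 - x0) * q)
    rw [← hm] at h1 h2
    have ht0 : 0 ≤ t := by
      rw [ht, sub_nonneg, div_le_iff₀ hqr]; exact h1
    have ht1 : t ≤ 1 / q := by
      rw [ht, sub_le_iff_le_add, ← add_div, le_div_iff₀ hqr]; linarith
    have := dk_core f u v hu hv huv α q p hp hα x0 t hx0.1 hx0.2.le ht0 ht1
    rw [← hC] at this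
    have e : F (y0 : UnitAddCircle) = ∑ k : ZMod q, f (((x0 + t : ℝ) : UnitAddCircle) + ZMod.toAddCircle k) := by
      rw [hF]
      rw [← Equiv.sum_comp (Equiv.addLeft ((m : ℤ) : ZMod q)) (fun k => f (((x0 + t : ℝ) : UnitAddCircle) + ZMod.toAddCircle k))]
      apply Finset.sum_congr rfl
      intro k _
      simp only [Equiv.coe_addLeft, map_add, ZMod.toAddCircle_intCast]
      rw [← add_assoc, ← AddCircle.coe_add]
      congr 3
      rw [ht]; ring
    show |S - F (y0 : UnitAddCircle)| ≤ C
    rw [e]; exact this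
  have hint : ∀ g : UnitAddCircle → ℝ, Continuous g → Integrable g :=
    fun g hg => hg.integrable_of_hasCompactSupport (HasCompactSupport.of_compactSpace g)
  have hFint : ∫ y, F y = 0 := by
    rw [hF, integral_finsetSum]
    · apply Finset.sum_eq_zero
      intro k _
      rw [integral_add_right_eq_self f]; exact h0
    · intro k _
      exact hint _ (by fun_prop)
  have hFi : Integrable F := hint _ (by rw [hF]; fun_prop)
  have i1 : ∫ y : UnitAddCircle, (S - F y) = S := by
    rw [integral_sub (integrable_const _) hFi, hFint]; simp [measureReal_def]
  rw [← i1]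
  calc |∫ y : UnitAddCircle, (S - F y)| ≤ ∫ y : UnitAddCircle, |S - F y| := abs_integral_le_integral_abs
    _ ≤ ∫ y : UnitAddCircle, C := integral_mono (((integrable_const S).sub hFi).abs) (integrable_const _) key
    _ = C := by simp [measureReal_def]

lemma denjoy_koksma (f : UnitAddCircle → ℝ) (h : ZeroMeanBV f) :
    ∃ C : ℝ, ∀ (α : ℝ) (q : ℕ) (p : ℤ), 0 < q → IsCoprime p (q : ℤ) → |q * α - p| ≤ 2 / q →
      ∀ x : UnitAddCircle, |∑ j ∈ range q, f (x + j • (α : UnitAddCircle))| ≤ C := by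
  obtain ⟨hc, hbv, h0⟩ := h
  obtain ⟨u, v, hu, hv, huv⟩ :=
    (bv_ext f hbv).locallyBoundedVariationOn.exists_monotoneOn_sub_monotoneOn
  refine ⟨4 * ((u 3 + v 3) - (u (-2) + v (-2))), fun α q p hq hp hα x => ?_⟩
  have : NeZero q := ⟨hq.ne'⟩
  exact dk_upper f hc h0 _ u v hu hv huv rfl α q p hp hα x

lemma cts_int {E : Type*} [NormedAddCommGroup E] (m : Measure UnitAddCircle) [IsFiniteMeasure m]
    (g : UnitAddCircle → E) (hg : Continuous g) : Integrable g m :=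
  hg.integrable_of_hasCompactSupport (HasCompactSupport.of_compactSpace g)

def intCLM (m : Measure UnitAddCircle) [IsFiniteMeasure m] : C(UnitAddCircle, ℂ) →L[ℂ] ℂ :=
  LinearMap.mkContinuous
    { toFun := fun g => ∫ z, g z ∂m
      map_add' := fun g h => by
        simp only [ContinuousMap.add_apply]
        exact integral_add (cts_int m _ g.continuous) (cts_int m _ h.continuous)
      map_smul' := fun c g => by
        simp only [ContinuousMap.smul_apply, RingHom.id_apply]
        exact integral_smul c _ } (m.real Set.univ)
    (fun g => by
      have := norm_integral_le_of_norm_le_const (μ := m) (f := g) (C := ‖g‖)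
        (Eventually.of_forall fun z => g.norm_coe_le_norm z)
      rw [mul_comm]
      exact this)

lemma intCLM_apply (m : Measure UnitAddCircle) [IsFiniteMeasure m] (g : C(UnitAddCircle, ℂ)) :
    intCLM m g = ∫ z, g z ∂m := rfl

lemma fourier_ne_one (α : ℝ) (hα : Irrational α) (n : ℤ) (hn : n ≠ 0) :
    fourier n (α : UnitAddCircle) ≠ (1 : ℂ) := by
  intro h
  rw [fourier_apply] at h
  have h1 : AddCircle.toCircle (n • (α : UnitAddCircle)) = 1 := by
    exact Circle.ext (by simpa using h)
  rw [← AddCircle.toCircle_zero (T := (1 : ℝ))] at h1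
  have h2 := AddCircle.injective_toCircle one_ne_zero h1
  rw [← AddCircle.coe_zsmul, AddCircle.coe_eq_zero_iff] at h2
  obtain ⟨m, hm⟩ := h2
  have h3 : Irrational ((n : ℝ) * α) := hα.intCast_mul hn
  simp only [zsmul_eq_mul, mul_one] at hm
  rw [← hm] at h3
  exact Int.not_irrational m h3

lemma fourier_shift (n : ℤ) (z a : UnitAddCircle) :
    (fourier n (z + a) : ℂ) = fourier n a * fourier n z := by
  simp only [fourier_apply, smul_add, AddCircle.toCircle_add, Circle.coe_mul]
  ring

lemma inv_signed (α : ℝ) (hα : Irrational α) (m1 m2 : Measure UnitAddCircle) [IsFiniteMeasure m1]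
    [IsFiniteMeasure m2]
    (h : ∀ g : C(UnitAddCircle, ℂ), ∫ z, g (z + (α : UnitAddCircle)) ∂m1 + ∫ z, g z ∂m2 =
      ∫ z, g z ∂m1 + ∫ z, g (z + (α : UnitAddCircle)) ∂m2) :
    ∃ c : ℝ, ∀ g : UnitAddCircle → ℝ, Continuous g →
      ∫ z, g z ∂m1 = ∫ z, g z ∂m2 + c * ∫ z, g z := by
  set c : ℝ := m1.real Set.univ - m2.real Set.univ with hc
  refine ⟨c, ?_⟩
  have hL : intCLM m1 - intCLM m2 = (c : ℂ) • intCLM volume := by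
    apply ContinuousLinearMap.ext_on (s := Set.range (fourier (T := (1 : ℝ))))
    · exact Submodule.dense_iff_topologicalClosure_eq_top.2 span_fourier_closure_eq_top
    · rintro _ ⟨n, rfl⟩
      simp only [_root_.sub_apply, _root_.smul_apply, intCLM_apply]
      by_cases hn : n = 0
      · subst hn
        simp [hc, measureReal_def]
      · have hne := fourier_ne_one α hα n hn
        have h1 := h (fourier n)
        simp only [fourier_shift] at h1
        rw [integral_const_mul, integral_const_mul] at h1
        have h2 : ∫ z : UnitAddCircle, (fourier n (z + (α : UnitAddCircle)) : ℂ) =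
          ∫ z : UnitAddCircle, (fourier n z : ℂ) := integral_add_right_eq_self _ _
        simp only [fourier_shift] at h2
        rw [integral_const_mul] at h2
        have hne' : (fourier n (α : UnitAddCircle) : ℂ) - 1 ≠ 0 := sub_ne_zero.2 hne
        have e2 : ∫ z : UnitAddCircle, (fourier n z : ℂ) = 0 := by
          apply mul_left_cancel₀ hne'
          linear_combination h2
        have e1 : ∫ z, (fourier n z : ℂ) ∂m1 - ∫ z, (fourier n z : ℂ) ∂m2 = 0 := by
          apply mul_left_cancel₀ hne'
          linear_combination h1
        rw [e1, e2]; simp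
  intro g hg
  have := congrArg (fun L => L (⟨fun z => (g z : ℂ), by fun_prop⟩ : C(UnitAddCircle, ℂ))) hL
  simp only [_root_.sub_apply, _root_.smul_apply, intCLM_apply,
    ContinuousMap.coe_mk, smul_eq_mul] at this
  have hof : ∀ m : Measure UnitAddCircle, ∫ z, (g z : ℂ) ∂m = ((∫ z, g z ∂m : ℝ) : ℂ) :=
    fun m => integral_ofReal
  rw [hof, hof, hof] at this
  have : ∫ z, g z ∂m1 - ∫ z, g z ∂m2 = c * ∫ z, g z := by exact_mod_cast this
  linarith

lemma pOf_pos (f : UnitAddCircle → ℝ) (z : UnitAddCircle) : 0 < pOf f z := by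
  unfold pOf; positivity

lemma one_sub_pOf (f : UnitAddCircle → ℝ) (z : UnitAddCircle) :
    1 - pOf f z = 1 / (1 + Real.exp (f z)) := by
  unfold pOf
  have : 1 + Real.exp (f z) ≠ 0 := by positivity
  field_simp; ring

lemma pOf_lt (f : UnitAddCircle → ℝ) (z : UnitAddCircle) : 0 < 1 - pOf f z := by
  rw [one_sub_pOf]; positivity

lemma pOf_eq (f : UnitAddCircle → ℝ) (z : UnitAddCircle) :
    pOf f z = Real.exp (f z) * (1 - pOf f z) := by
  rw [one_sub_pOf]; unfold pOf; ring

lemma pOf_cont (f : UnitAddCircle → ℝ) (hf : Continuous f) : Continuous (pOf f) := by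
  unfold pOf
  apply Continuous.div (by fun_prop) (by fun_prop)
  intro z; positivity

lemma finite_wd (m : Measure UnitAddCircle) [IsFiniteMeasure m] (w : UnitAddCircle → ℝ)
    (hw : Continuous w) : IsFiniteMeasure (m.withDensity fun z => ENNReal.ofReal (w z)) :=
  isFiniteMeasure_withDensity_ofReal (cts_int m w hw).2

lemma int_wd {E : Type*} [NormedAddCommGroup E] [NormedSpace ℝ E] (m : Measure UnitAddCircle)
    (w : UnitAddCircle → ℝ)
    (hw : Continuous w) (h0 : ∀ z, 0 ≤ w z) (g : UnitAddCircle → E) :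
    ∫ z, g z ∂(m.withDensity fun z => ENNReal.ofReal (w z)) = ∫ z, w z • g z ∂m := by
  rw [integral_withDensity_eq_integral_toReal_smul (by fun_prop) (by simp)]
  simp only [ENNReal.toReal_ofReal (h0 _)]

/-- The measure `qμ`. -/
def nuOf (f : UnitAddCircle → ℝ) (μ : Measure UnitAddCircle) : Measure UnitAddCircle :=
  μ.withDensity fun z => ENNReal.ofReal (1 - pOf f z)

lemma flux (α : ℝ) (hα : Irrational α) (f : UnitAddCircle → ℝ) (hf : Continuous f)
    (μ : Measure UnitAddCircle) [IsProbabilityMeasure μ] (hμ : Pop (pOf f) α μ = μ) :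
    ∃ c : ℝ, ∀ g : UnitAddCircle → ℝ, Continuous g →
      ∫ z, g (z + (α : UnitAddCircle)) * Real.exp (f z) ∂(nuOf f μ) =
        ∫ z, g z ∂(nuOf f μ) + c * ∫ z, g z := by
  have hpc := pOf_cont f hf
  set a : UnitAddCircle := (α : UnitAddCircle) with ha
  set mp : Measure UnitAddCircle := μ.withDensity fun z => ENNReal.ofReal (pOf f z) with hmp
  have f1 : IsFiniteMeasure mp := finite_wd μ _ hpc
  have f2 : IsFiniteMeasure (nuOf f μ) := finite_wd μ (fun z => 1 - pOf f z) (by fun_prop)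
  have hm1 : Measurable (fun z : UnitAddCircle => z + a) := by fun_prop
  have hm2 : Measurable (fun z : UnitAddCircle => z - a) := by fun_prop
  have hsum : mp + nuOf f μ = μ := by
    rw [hmp, nuOf, ← withDensity_add_left (by fun_prop)]
    conv_rhs => rw [← withDensity_one (μ := μ)]
    congr 1
    ext z
    simp only [Pi.add_apply, Pi.one_apply]
    rw [← ENNReal.ofReal_add (pOf_pos f z).le (pOf_lt f z).le]; simp
  have hst : mp.map (fun z => z + a) + (nuOf f μ).map (fun z => z - a) = μ := hμ
  have hkey : (mp.map (fun z => z + a)).map (fun z => z + a) + nuOf f μ =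
      mp.map (fun z => z + a) + (nuOf f μ).map (fun z => z + a) := by
    have h1 := congrArg (Measure.map (fun z => z + a)) (hst.trans hsum.symm)
    rw [Measure.map_add _ _ hm1, Measure.map_add _ _ hm1, Measure.map_map hm1 hm2] at h1
    have : (fun z : UnitAddCircle => z + a) ∘ (fun z => z - a) = id := by ext z; simp
    rwa [this, Measure.map_id] at h1
  obtain ⟨c, hc⟩ := inv_signed α hα (mp.map (fun z => z + a)) (nuOf f μ) (by
    intro g
    have h1 := congrArg (fun m => ∫ z, g z ∂m) hkey
    have hg : Continuous (fun z => g z) := g.continuous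
    rw [integral_add_measure (cts_int _ _ hg) (cts_int _ _ hg),
      integral_add_measure (cts_int _ _ hg) (cts_int _ _ hg),
      integral_map hm1.aemeasurable hg.aestronglyMeasurable,
      integral_map (μ := nuOf f μ) hm1.aemeasurable hg.aestronglyMeasurable] at h1
    exact h1)
  refine ⟨c, fun g hg => ?_⟩
  rw [← hc g hg, integral_map hm1.aemeasurable hg.aestronglyMeasurable, hmp, nuOf,
    int_wd μ _ hpc (fun z => (pOf_pos f z).le),
    int_wd μ (fun z => 1 - pOf f z) (by fun_prop) (fun z => (pOf_lt f z).le)]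
  congr 1
  ext z
  simp only [smul_eq_mul]
  conv_rhs => rw [pOf_eq f z]
  ring

/-- Birkhoff sums. -/
def bsum (f : UnitAddCircle → ℝ) (a : UnitAddCircle) (n : ℕ) (z : UnitAddCircle) : ℝ :=
  ∑ j ∈ range n, f (z + j • a)

lemma bsum_cont (f : UnitAddCircle → ℝ) (hf : Continuous f) (a : UnitAddCircle) (n : ℕ) :
    Continuous (bsum f a n) := by
  unfold bsum; fun_prop

lemma bsum_succ (f : UnitAddCircle → ℝ) (a : UnitAddCircle) (n : ℕ) (z : UnitAddCircle) :
    bsum f a (n + 1) z = bsum f a n (z + a) + f z := by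
  unfold bsum
  rw [Finset.sum_range_succ']
  simp only [zero_smul, add_zero, succ_nsmul']
  congr 1
  apply Finset.sum_congr rfl
  intro j _
  rw [add_assoc]

lemma flux_iter (f : UnitAddCircle → ℝ) (hf : Continuous f) (a : UnitAddCircle)
    (ν : Measure UnitAddCircle) (c : ℝ)
    (h : ∀ g : UnitAddCircle → ℝ, Continuous g →
      ∫ z, g (z + a) * Real.exp (f z) ∂ν = ∫ z, g z ∂ν + c * ∫ z, g z)
    (g : UnitAddCircle → ℝ) (hg : Continuous g) (n : ℕ) :
    ∫ z, g (z + n • a) * Real.exp (bsum f a n z) ∂ν =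
      ∫ z, g z ∂ν + c * ∑ k ∈ range n, ∫ z, g (z + k • a) * Real.exp (bsum f a k z) := by
  induction n with
  | zero => simp [bsum]
  | succ n ih =>
    have hb := bsum_cont f hf a n
    have h1 := h (fun z => g (z + n • a) * Real.exp (bsum f a n z)) (by fun_prop)
    rw [ih] at h1
    rw [Finset.sum_range_succ, mul_add, ← add_assoc, ← h1]
    congr 1
    ext z
    rw [bsum_succ, Real.exp_add, succ_nsmul' a n, add_assoc]
    ring

lemma flux_zero (α : ℝ) (hα : Irrational α) (f : UnitAddCircle → ℝ) (hf : ZeroMeanBV f)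
    (ν : Measure UnitAddCircle) [IsFiniteMeasure ν] (c : ℝ)
    (h : ∀ g : UnitAddCircle → ℝ, Continuous g →
      ∫ z, g (z + (α : UnitAddCircle)) * Real.exp (f z) ∂ν = ∫ z, g z ∂ν + c * ∫ z, g z) :
    c = 0 := by
  obtain ⟨C, hC⟩ := denjoy_koksma f hf
  obtain ⟨hc, -, h0⟩ := hf
  set a : UnitAddCircle := (α : UnitAddCircle)
  have hint : ∀ k, (1 : ℝ) ≤ ∫ z, Real.exp (bsum f a k z) := by
    intro k
    have hb := bsum_cont f hc a k
    have h1 : ∫ z, (bsum f a k z + 1) = 1 := by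
      rw [integral_add (cts_int _ _ hb) (integrable_const _)]
      unfold bsum
      rw [integral_finsetSum _ (fun j _ => cts_int _ _ (by fun_prop))]
      rw [Finset.sum_eq_zero]
      · simp [measureReal_def]
      · intro j _
        rw [integral_add_right_eq_self f]; exact h0
    refine h1.symm.le.trans ?_
    apply integral_mono (cts_int _ _ (by fun_prop)) (cts_int _ _ (by fun_prop))
    intro z
    exact Real.add_one_le_exp _
  have hsum : ∀ n : ℕ, (n : ℝ) ≤ ∑ k ∈ range n, ∫ z, Real.exp (bsum f a k z) := by
    intro n
    calc (n : ℝ) = ∑ k ∈ range n, (1 : ℝ) := by simp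
      _ ≤ _ := Finset.sum_le_sum fun k _ => hint k
  have hit : ∀ n : ℕ, ∫ z, Real.exp (bsum f a n z) ∂ν =
      ν.real Set.univ + c * ∑ k ∈ range n, ∫ z, Real.exp (bsum f a k z) := by
    intro n
    have := flux_iter f hc a ν c h (fun _ => 1) (by fun_prop) n
    simpa using this
  rcases lt_trichotomy c 0 with hneg | hz | hpos
  · exfalso
    obtain ⟨n, hn⟩ := exists_nat_gt (ν.real Set.univ / (-c))
    rw [div_lt_iff₀ (by linarith)] at hn
    have h1 : 0 ≤ ∫ z, Real.exp (bsum f a n z) ∂ν := integral_nonneg fun z => (Real.exp_pos _).le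
    rw [hit n] at h1
    nlinarith [hsum n]
  · exact hz
  · exfalso
    obtain ⟨n, hn⟩ := exists_nat_gt (Real.exp C * ν.real Set.univ / c)
    rw [div_lt_iff₀ hpos] at hn
    obtain ⟨q, p, hq, -, hcop, hap⟩ := odd_return α hα n
    have h1 : ∫ z, Real.exp (bsum f a q z) ∂ν ≤ ∫ z, Real.exp C ∂ν := by
      have hb := bsum_cont f hc a q
      apply integral_mono (cts_int _ _ (by fun_prop)) (integrable_const _)
      intro z
      exact Real.exp_le_exp.2 ((le_abs_self _).trans (hC α q p (by omega) hcop hap z))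
    rw [hit q] at h1
    simp only [integral_const, smul_eq_mul] at h1
    have h2 : (n : ℝ) ≤ q := by exact_mod_cast hq.le
    have h3 : 0 ≤ ν.real Set.univ := measureReal_nonneg
    nlinarith [hsum q]

lemma conformal (f : UnitAddCircle → ℝ) (hf : Continuous f) (a : UnitAddCircle)
    (ν : Measure UnitAddCircle) [IsFiniteMeasure ν]
    (h : ∀ g : UnitAddCircle → ℝ, Continuous g →
      ∫ z, g (z + a) * Real.exp (f z) ∂ν = ∫ z, g z ∂ν + 0 * ∫ z, g z) (n : ℕ) :
    (ν.withDensity fun z => ENNReal.ofReal (Real.exp (bsum f a n z))).map (fun z => z + n • a) = ν := by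
  have hb := bsum_cont f hf a n
  have : IsFiniteMeasure (ν.withDensity fun z => ENNReal.ofReal (Real.exp (bsum f a n z))) :=
    finite_wd ν (fun z => Real.exp (bsum f a n z)) (by fun_prop)
  apply ext_of_forall_integral_eq_of_IsFiniteMeasure
  intro g
  have hg : Continuous (fun z => g z) := g.continuous
  rw [integral_map (by fun_prop) hg.aestronglyMeasurable,
    int_wd ν (fun z => Real.exp (bsum f a n z)) (by fun_prop) (fun z => (Real.exp_pos _).le)]
  have := flux_iter f hf a ν 0 h (fun z => g z) hg n
  rw [zero_mul, add_zero] at this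
  rw [← this]
  congr 1
  ext z
  simp only [smul_eq_mul]; ring

lemma return_bound (f : UnitAddCircle → ℝ) (a : UnitAddCircle)
    (ν : Measure UnitAddCircle) [IsFiniteMeasure ν] (n : ℕ) (C : ℝ)
    (h : (ν.withDensity fun z => ENNReal.ofReal (Real.exp (bsum f a n z))).map
      (fun z => z + n • a) = ν)
    (hC : ∀ z, |bsum f a n z| ≤ C) (E : Set UnitAddCircle) (hE : MeasurableSet E) :
    ENNReal.ofReal (Real.exp (-C)) * ν ((fun z => z + n • a) ⁻¹' E) ≤ ν E := by
  have hm : Measurable (fun z : UnitAddCircle => z + n • a) := by fun_prop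
  conv_rhs => rw [← h]
  rw [Measure.map_apply hm hE, withDensity_apply _ (hm hE)]
  rw [← setLIntegral_const]
  apply lintegral_mono
  intro z
  apply ENNReal.ofReal_le_ofReal
  apply Real.exp_le_exp.2
  have := (abs_le.1 (hC z)).1
  exact this

lemma no_swap (α : ℝ) (hα : Irrational α) (f : UnitAddCircle → ℝ) (hf : ZeroMeanBV f)
    (ν : Measure UnitAddCircle) [IsFiniteMeasure ν]
    (h : ∀ g : UnitAddCircle → ℝ, Continuous g →
      ∫ z, g (z + (α : UnitAddCircle)) * Real.exp (f z) ∂ν = ∫ z, g z ∂ν + 0 * ∫ z, g z)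
    (A : Set UnitAddCircle) (hA : MeasurableSet A)
    (hs : ∀ n : ℕ, Odd n → ∀ᵐ z ∂ν, z ∈ A → z + n • (α : UnitAddCircle) ∉ A) : ν A = 0 := by
  by_contra hne
  obtain ⟨C, hC⟩ := denjoy_koksma f hf
  obtain ⟨hc, -, -⟩ := hf
  set a : UnitAddCircle := (α : UnitAddCircle) with ha
  obtain ⟨K, hKA, hK, hKpos⟩ := hA.exists_lt_isCompact (μ := ν) (pos_iff_ne_zero.2 hne)
  set e := ENNReal.ofReal (Real.exp (-C)) with he
  have he0 : e ≠ 0 := by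
    rw [he]; simp [Real.exp_pos]
  have hfin : ν K ≠ ⊤ := measure_ne_top _ _
  obtain ⟨U, hKU, hU, hUlt⟩ := K.exists_isOpen_lt_of_lt (μ := ν) (ν K + e * ν K)
    (ENNReal.lt_add_right hfin (mul_ne_zero he0 hKpos.ne'))
  obtain ⟨δ, hδ, hthick⟩ := hK.exists_thickening_subset_open hU hKU
  obtain ⟨N, hN⟩ := exists_nat_gt (2 / δ)
  obtain ⟨q, p, hq, hodd, hcop, hap⟩ := odd_return α hα N
  have hqr : (0 : ℝ) < q := by exact_mod_cast (by omega : 0 < q)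
  have hsmall : ‖q • a‖ < δ := by
    have h1 : ‖q • a‖ ≤ |q * α - p| := by
      rw [ha, ← AddCircle.coe_nsmul, UnitAddCircle.norm_eq, nsmul_eq_mul]
      exact round_le _ _
    have h2 : 2 / (q : ℝ) < δ := by
      rw [div_lt_iff₀ hqr]
      rw [div_lt_iff₀ hδ] at hN
      have : (N : ℝ) ≤ q := by exact_mod_cast hq.le
      nlinarith
    linarith
  have hb := return_bound f a ν q C (conformal f hc a ν h q)
    (fun z => hC α q p (by omega) hcop hap z) (U \ K) (hU.measurableSet.diff hK.measurableSet)
  have hKsub : ν K ≤ ν ((fun z => z + q • a) ⁻¹' (U \ K)) := by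
    apply measure_mono_ae
    filter_upwards [hs q hodd] with z hz hzK
    refine ⟨?_, fun hzK' => hz (hKA hzK) (hKA hzK')⟩
    apply hthick
    rw [Metric.mem_thickening_iff]
    refine ⟨z, hzK, ?_⟩
    rw [dist_eq_norm]; simpa using hsmall
  have hd : ν (U \ K) < e * ν K := by
    rw [measure_sdiff hKU hK.measurableSet.nullMeasurableSet hfin]
    exact ENNReal.sub_lt_of_lt_add (measure_mono hKU) (by rwa [add_comm])
  have : e * ν K ≤ ν (U \ K) := le_trans (by gcongr) hb
  exact absurd this (not_le.2 hd)

lemma quasi_inv (α : ℝ) (f : UnitAddCircle → ℝ) (hf : Continuous f)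
    (μ : Measure UnitAddCircle) (hμ : Pop (pOf f) α μ = μ)
    (P : UnitAddCircle → Prop) (hP : ∀ᵐ z ∂μ, P z) :
    (∀ᵐ z ∂μ, P (z + (α : UnitAddCircle))) ∧ (∀ᵐ z ∂μ, P (z - (α : UnitAddCircle))) := by
  have hpc := pOf_cont f hf
  rw [← hμ, Pop, ae_add_measure_iff] at hP
  obtain ⟨h1, h2⟩ := hP
  have h1 := ae_of_ae_map (by fun_prop) h1
  have h2 := ae_of_ae_map (by fun_prop) h2
  rw [ae_withDensity_iff (by fun_prop)] at h1 h2
  constructor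
  · filter_upwards [h1] with z hz
    exact hz (by simpa using pOf_pos f z)
  · filter_upwards [h2] with z hz
    exact hz (by have := pOf_lt f z; simp only [ne_eq, ENNReal.ofReal_eq_zero, not_le]; exact this)

lemma zero_one (α : ℝ) (f : UnitAddCircle → ℝ) (hf : Continuous f)
    (μ : Measure UnitAddCircle) (hμ : IsUniqueStationary (pOf f) α μ)
    (B : Set UnitAddCircle) (hB : MeasurableSet B)
    (h : ∀ᵐ z ∂μ, z + (α : UnitAddCircle) ∈ B ↔ z ∈ B) : μ B = 0 ∨ μ B = 1 := by
  obtain ⟨hprob, hst, huniq⟩ := hμ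
  by_cases h0 : μ B = 0
  · exact Or.inl h0
  right
  have hpc := pOf_cont f hf
  set a : UnitAddCircle := (α : UnitAddCircle) with ha
  have hm1 : Measurable (fun z : UnitAddCircle => z + a) := by fun_prop
  have hm2 : Measurable (fun z : UnitAddCircle => z - a) := by fun_prop
  have h' : ∀ᵐ z ∂μ, z - a ∈ B ↔ z ∈ B := by
    filter_upwards [(quasi_inv α f hf μ hst _ h).2] with z hz
    simp only [← ha, sub_add_cancel] at hz
    exact hz.symm
  have hr : Pop (pOf f) α (μ.restrict B) = μ.restrict B := by
    conv_rhs => rw [← hst]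
    unfold Pop
    rw [Measure.restrict_add, Measure.restrict_map hm1 hB, Measure.restrict_map hm2 hB,
      ← restrict_withDensity hB, ← restrict_withDensity hB]
    congr 2
    · apply Measure.restrict_congr_set
      apply (withDensity_absolutelyContinuous μ _).ae_le
      filter_upwards [h] with z hz
      exact propext hz.symm
    · apply Measure.restrict_congr_set
      apply (withDensity_absolutelyContinuous μ _).ae_le
      filter_upwards [h'] with z hz
      exact propext hz.symm
  have hfin : μ B ≠ ⊤ := measure_ne_top _ _
  have hρ := huniq ((μ B)⁻¹ • μ.restrict B)
    ⟨by simp [ENNReal.inv_mul_cancel h0 hfin]⟩ (by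
      conv_rhs => rw [← hr]
      unfold Pop
      rw [withDensity_smul_measure, withDensity_smul_measure, Measure.map_smul, Measure.map_smul,
        smul_add])
  have : μ Bᶜ = 0 := by
    rw [← hρ]
    simp [Measure.restrict_apply hB.compl]
  exact (prob_compl_eq_zero_iff hB).1 this

/-- Lemma 3.2: if `𝔣` is continuous of bounded variation with
`∫_𝕋 𝔣 = 0` and `μ⋆` is the unique stationary measure of the kernel
`p(x,·) = 𝔭(x)δ_{x+α} + 𝔮(x)δ_{x-α}`, then `μ⋆` is ergodic with respect to the
two-step kernel `p₂(x,·) = 𝔭(x)²δ_{x+2α} + 2𝔭(x)𝔮(x)δ_x + 𝔮(x)²δ_{x-2α}`: every Borel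
set `A` with `p₂(x,A) = 1` for `μ⋆`-a.e. `x ∈ A` has `μ⋆(A) = 0` or `μ⋆(A) = 1`. -/
theorem statement12 (α : ℝ) (hα : Irrational α) (𝔣 : UnitAddCircle → ℝ)
    (h𝔣 : ZeroMeanBV 𝔣) (μstar : Measure UnitAddCircle)
    (hμ : IsUniqueStationary (pOf 𝔣) α μstar)
    (A : Set UnitAddCircle) (hA : MeasurableSet A)
    (hinv : ∀ᵐ z ∂μstar, z ∈ A →
      (pOf 𝔣 z) ^ 2 * A.indicator (fun _ => (1 : ℝ)) (z + ((2 * α : ℝ) : UnitAddCircle)) +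
        2 * pOf 𝔣 z * (1 - pOf 𝔣 z) * A.indicator (fun _ => (1 : ℝ)) z +
        (1 - pOf 𝔣 z) ^ 2 *
          A.indicator (fun _ => (1 : ℝ)) (z - ((2 * α : ℝ) : UnitAddCircle)) = 1) :
    μstar A = 0 ∨ μstar A = 1 := by
  classical
  obtain ⟨hprob, hst, huniq⟩ := id hμ
  have hc : Continuous 𝔣 := h𝔣.1
  set a : UnitAddCircle := (α : UnitAddCircle) with ha
  have h2a : ((2 * α : ℝ) : UnitAddCircle) = a + a := by
    rw [two_mul, AddCircle.coe_add]
  have hA2 : ∀ᵐ z ∂μstar, z ∈ A → (z + a + a ∈ A ∧ z - a - a ∈ A) := by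
    filter_upwards [hinv] with z hz hzA
    have h1 := hz hzA
    rw [h2a, ← add_assoc, ← sub_sub] at h1
    have hp := pOf_pos 𝔣 z
    have hp' := pOf_lt 𝔣 z
    rw [Set.indicator_of_mem hzA] at h1
    by_cases i1 : z + a + a ∈ A <;> by_cases i2 : z - a - a ∈ A
    · exact ⟨i1, i2⟩
    · rw [Set.indicator_of_mem i1, Set.indicator_of_notMem i2] at h1
      exfalso; nlinarith [sq_nonneg (pOf 𝔣 z), mul_pos hp' hp']
    · rw [Set.indicator_of_notMem i1, Set.indicator_of_mem i2] at h1
      exfalso; nlinarith [mul_pos hp hp]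
    · rw [Set.indicator_of_notMem i1, Set.indicator_of_notMem i2] at h1
      exfalso; nlinarith [mul_pos hp hp, mul_pos hp' hp']
  have hiff : ∀ᵐ z ∂μstar, z + a + a ∈ A ↔ z ∈ A := by
    have h1 := (quasi_inv α 𝔣 hc μstar hst _ (quasi_inv α 𝔣 hc μstar hst _ hA2).1).1
    filter_upwards [hA2, h1] with z hz hz'
    simp only [← ha, add_sub_cancel_right] at hz'
    exact ⟨fun h => (hz' h).2, fun h => (hz h).1⟩
  have hm1 : Measurable (fun z : UnitAddCircle => z + a) := by fun_prop
  have hA' : MeasurableSet ((fun z : UnitAddCircle => z + a) ⁻¹' A) := hm1 hA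
  rcases zero_one α 𝔣 hc μstar hμ (A ∩ (fun z => z + a) ⁻¹' A) (hA.inter hA') (by
    filter_upwards [hiff] with z hz
    simp only [Set.mem_inter_iff, Set.mem_preimage, ← ha]
    tauto) with hi | hi
  swap
  · right
    exact le_antisymm prob_le_one (hi ▸ measure_mono Set.inter_subset_left)
  rcases zero_one α 𝔣 hc μstar hμ (A ∪ (fun z => z + a) ⁻¹' A) (hA.union hA') (by
    filter_upwards [hiff] with z hz
    simp only [Set.mem_union, Set.mem_preimage, ← ha]
    tauto) with hu | hu
  · left
    exact measure_mono_null Set.subset_union_left hu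
  left
  have hswap : ∀ᵐ z ∂μstar, z ∈ A → z + a ∉ A := by
    have : ∀ᵐ z ∂μstar, z ∉ A ∩ (fun z => z + a) ⁻¹' A := measure_eq_zero_iff_ae_notMem.1 hi
    filter_upwards [this] with z hz h1 h2
    exact hz ⟨h1, h2⟩
  have hswapn : ∀ k : ℕ, ∀ᵐ z ∂μstar, z ∈ A → z + (2 * k + 1) • a ∉ A := by
    intro k
    induction k with
    | zero => simpa using hswap
    | succ k ih =>
      have h1 := (quasi_inv α 𝔣 hc μstar hst _ (quasi_inv α 𝔣 hc μstar hst _ ih).1).1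
      filter_upwards [hiff, h1] with z hz hz' hzA
      have := hz' (hz.2 hzA)
      rw [← ha] at this
      convert this using 2
      rw [show 2 * (k + 1) + 1 = (2 * k + 1) + 1 + 1 by ring, succ_nsmul, succ_nsmul]
      abel
  obtain ⟨c, hflux⟩ := flux α hα 𝔣 hc μstar hst
  have hfin : IsFiniteMeasure (nuOf 𝔣 μstar) :=
    finite_wd μstar (fun z => 1 - pOf 𝔣 z) (by have := pOf_cont 𝔣 hc; fun_prop)
  have hc0 := flux_zero α hα 𝔣 h𝔣 (nuOf 𝔣 μstar) c hflux
  subst hc0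
  have hν := no_swap α hα 𝔣 h𝔣 (nuOf 𝔣 μstar) hflux A hA (by
    rintro n ⟨k, rfl⟩
    exact (withDensity_absolutelyContinuous μstar _).ae_le (hswapn k))
  have hν' : ∀ᵐ z ∂(nuOf 𝔣 μstar), z ∉ A := measure_eq_zero_iff_ae_notMem.1 hν
  have hpc := pOf_cont 𝔣 hc
  rw [nuOf, ae_withDensity_iff (by fun_prop)] at hν'
  rw [measure_eq_zero_iff_ae_notMem]
  filter_upwards [hν'] with z hz
  exact hz (by have := pOf_lt 𝔣 z; simp only [ne_eq, ENNReal.ofReal_eq_zero, not_le]; exact this)
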